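/- (Takagi / Autonne–Takagi factorization) Every complex symmetric N×N matrix B admits a decomposition B = W·D·Wᵀ, where W is an N×N unitary matrix, D is an N×N diagonal matrix with nonnegative real diagonal entries, and Wᵀ is the (non-conjugate) transpose of W. -/

import Mathlib

open Matrix

section Coneigenvectors

variable {E : Type*} [NormedAddCommGroup E] [InnerProductSpace ℂ E] [FiniteDimensional ℂ E]

/-- A conjugate-linear map on a nontrivial space that is symmetric in the sense
`⟪x, T y⟫ = ⟪y, T x⟫` has a unit coneigenvector with nonnegative coneigenvalue. -/
theorem exists_coneigenvector_of_nontrivial [Nontrivial E] (T : E →ₗ⋆[ℂ] E)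
    (hT : ∀ x y, inner ℂ x (T y) = inner ℂ y (T x)) :
    ∃ (x : E) (s : ℝ), ‖x‖ = 1 ∧ 0 ≤ s ∧ T x = (s : ℂ) • x := by
  let : InnerProductSpace ℝ E := InnerProductSpace.complexToReal
  let S : E →ₗ[ℝ] E :=
    { toFun := T
      map_add' := T.map_add
      map_smul' := fun r x => by
        rw [← Complex.coe_smul, T.map_smulₛₗ, Complex.conj_ofReal, Complex.coe_smul]
        rfl }
  have hS : S.IsSymmetric := fun x y => by
    change (inner ℂ (T x) y).re = (inner ℂ x (T y)).re
    rw [hT x y, ← inner_conj_symm, Complex.conj_re]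
  have : FiniteDimensional ℝ E := FiniteDimensional.complexToReal E
  have hpos : 0 < Module.finrank ℝ E := Module.finrank_pos
  let i : Fin (Module.finrank ℝ E) := ⟨0, hpos⟩
  let x := hS.eigenvectorBasis rfl i
  have hx1 : ‖x‖ = 1 := (hS.eigenvectorBasis rfl).orthonormal.1 i
  have hTx : T x = ((hS.eigenvalues rfl i : ℝ) : ℂ) • x := hS.apply_eigenvectorBasis rfl i
  rcases le_total 0 (hS.eigenvalues rfl i) with h | h
  · exact ⟨x, _, hx1, h, hTx⟩
  · refine ⟨Complex.I • x, -hS.eigenvalues rfl i, ?_, neg_nonneg.mpr h, ?_⟩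
    · rw [norm_smul, Complex.norm_I, one_mul, hx1]
    · rw [T.map_smulₛₗ, hTx, Complex.conj_I, smul_smul, smul_smul]
      congr 1
      push_cast
      ring

/-- The conclusion of `exists_coneigenvector_of_nontrivial` inside an invariant subspace. -/
theorem exists_coneigenvector_mem (T : E →ₗ⋆[ℂ] E)
    (hT : ∀ x y, inner ℂ x (T y) = inner ℂ y (T x)) (V : Submodule ℂ E) (hV : V ≠ ⊥)
    (hTV : ∀ x ∈ V, T x ∈ V) :
    ∃ x ∈ V, ∃ s : ℝ, ‖x‖ = 1 ∧ 0 ≤ s ∧ T x = (s : ℂ) • x := by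
  have := Submodule.nontrivial_iff_ne_bot.mpr hV
  obtain ⟨x, s, hx, hs, h⟩ := exists_coneigenvector_of_nontrivial
    ((T.domRestrict V).codRestrict V fun x => hTV x x.2) fun x y => hT x y
  exact ⟨x, x.2, s, hx, hs, congrArg Subtype.val h⟩

theorem exists_orthonormal_coneigenvectors (T : E →ₗ⋆[ℂ] E)
    (hT : ∀ x y, inner ℂ x (T y) = inner ℂ y (T x)) (k : ℕ) (hk : k ≤ Module.finrank ℂ E) :
    ∃ (v : Fin k → E) (d : Fin k → ℝ),
      Orthonormal ℂ v ∧ (∀ i, 0 ≤ d i) ∧ ∀ i, T (v i) = (d i : ℂ) • v i := by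
  induction k with
  | zero => exact ⟨Fin.elim0, Fin.elim0, ⟨fun i => i.elim0, fun i => i.elim0⟩,
      fun i => i.elim0, fun i => i.elim0⟩
  | succ k ih =>
    obtain ⟨v, d, hv, hd, hTv⟩ := ih (by omega)
    set V := (Submodule.span ℂ (Set.range v))ᗮ with hVdef
    have mem_V (x : E) : x ∈ V ↔ ∀ i, inner ℂ (v i) x = 0 := by
      rw [hVdef, Submodule.mem_orthogonal]
      refine ⟨fun h i => h _ (Submodule.subset_span ⟨i, rfl⟩), fun h u hu => ?_⟩
      induction hu using Submodule.span_induction with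
      | mem u hu => obtain ⟨i, rfl⟩ := hu; exact h i
      | zero => exact inner_zero_left x
      | add a b _ _ ha hb => rw [inner_add_left, ha, hb, add_zero]
      | smul c a _ ha => rw [inner_smul_left, ha, mul_zero]
    have hV : V ≠ ⊥ := fun h => by
      have h1 := (Submodule.span ℂ (Set.range v)).finrank_add_finrank_orthogonal
      rw [← hVdef, h, finrank_bot, finrank_span_eq_card hv.linearIndependent,
        Fintype.card_fin] at h1
      omega
    obtain ⟨x, hxV, s, hx, hs, hTx⟩ := exists_coneigenvector_mem T hT V hV fun x hx => by
      rw [mem_V] at hx ⊢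
      intro i
      rw [hT, hTv, inner_smul_right, inner_eq_zero_symm.mp (hx i), mul_zero]
    rw [mem_V] at hxV
    refine ⟨Fin.cons x v, Fin.cons s d, ⟨?_, ?_⟩, ?_, ?_⟩
    · exact Fin.cases hx hv.1
    · intro i j hij
      cases i using Fin.cases <;> cases j using Fin.cases
      · exact absurd rfl hij
      · exact inner_eq_zero_symm.mp (hxV _)
      · exact hxV _
      · exact hv.2 fun h => hij (congrArg Fin.succ h)
    · exact Fin.cases hs hd
    · exact Fin.cases hTx hTv

end Coneigenvectors

/-- The conjugate-linear map `x ↦ B * conj x` attached to a complex matrix `B`. -/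
noncomputable def Matrix.conjMulVecLin {n : Type*} [Fintype n] (B : Matrix n n ℂ) :
    EuclideanSpace ℂ n →ₗ⋆[ℂ] EuclideanSpace ℂ n where
  toFun x := WithLp.toLp 2 (B *ᵥ star x.ofLp)
  map_add' x y := by
    rw [WithLp.ofLp_add, star_add, mulVec_add, WithLp.toLp_add]
  map_smul' c x := by
    rw [WithLp.ofLp_smul, star_smul, mulVec_smul, WithLp.toLp_smul]
    rfl

theorem Matrix.inner_conjMulVecLin_comm {n : Type*} [Fintype n] {B : Matrix n n ℂ}
    (hB : Bᵀ = B) (x y : EuclideanSpace ℂ n) :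
    inner ℂ x (B.conjMulVecLin y) = inner ℂ y (B.conjMulVecLin x) := by
  rw [EuclideanSpace.inner_eq_star_dotProduct, EuclideanSpace.inner_eq_star_dotProduct]
  change (B *ᵥ star y.ofLp) ⬝ᵥ star x.ofLp = (B *ᵥ star x.ofLp) ⬝ᵥ star y.ofLp
  rw [dotProduct_comm, dotProduct_mulVec, ← mulVec_transpose, hB]

/-- Takagi / Autonne–Takagi factorization: every complex symmetric `N × N` matrix `B`
can be written as `B = W · D · Wᵀ` with `W` unitary and `D` diagonal with
nonnegative real entries. -/
theorem takagi_factorization {N : ℕ} (B : Matrix (Fin N) (Fin N) ℂ) (hB : Bᵀ = B) :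
    ∃ (W : Matrix (Fin N) (Fin N) ℂ) (d : Fin N → ℝ),
      Wᴴ * W = 1 ∧ W * Wᴴ = 1 ∧ (∀ i, 0 ≤ d i) ∧
      B = W * Matrix.diagonal (fun i => (d i : ℂ)) * Wᵀ := by
  obtain ⟨v, d, hv, hd, hTv⟩ := exists_orthonormal_coneigenvectors B.conjMulVecLin
    (inner_conjMulVecLin_comm hB) N finrank_euclideanSpace_fin.ge
  let W : Matrix (Fin N) (Fin N) ℂ := Matrix.of fun j i => v i j
  have hW : Wᴴ * W = 1 := by
    ext i j
    have h := orthonormal_iff_ite.mp hv i j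
    rw [EuclideanSpace.inner_eq_star_dotProduct, dotProduct_comm] at h
    rw [one_apply]
    exact h
  have hW' : W * Wᴴ = 1 := mul_eq_one_comm.mp hW
  have hBW : B * Wᴴᵀ = W * diagonal fun i => (d i : ℂ) := by
    ext j i
    rw [mul_diagonal, mul_comm]
    exact congrArg (fun x : EuclideanSpace ℂ (Fin N) => x j) (hTv i)
  refine ⟨W, d, hW, hW', hd, ?_⟩
  rw [← hBW, Matrix.mul_assoc, ← transpose_mul, hW', transpose_one, Matrix.mul_one]
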